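/- The patterns 2413 and 1423 are (Destop, Asctop, Ascbot, Peak, RLmax)-Wilf equivalent: for every n ≥ 0 and all sets T, A_t, A_b, P, R ⊆ [n], the number of permutations σ ∈ Av_n(2413) with Destop(σ) = T, Asctop(σ) = A_t, Ascbot(σ) = A_b, Peak(σ) = P, and RLmax(σ) = R equals the number of permutations σ ∈ Av_n(1423) with the same five set values. -/

import Mathlib

open scoped Classical

/-- The 1-based `i`-th entry of a permutation `σ` of `{1,…,n}`, as a value in `{1,…,n}`
(one-line notation `σ(1)…σ(n)`). -/
def entry {n : ℕ} (σ : Equiv.Perm (Fin n)) (i : ℕ) : ℕ :=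
  if h : i - 1 < n then (σ ⟨i - 1, h⟩ : ℕ) + 1 else 0

/-- `σ` contains the pattern `π ∈ S_k` (given in 0-based one-line notation as a function):
there is a (not necessarily consecutive) subsequence of `σ` order-isomorphic to `π`. -/
def Contains {n k : ℕ} (π : Fin k → Fin k) (σ : Equiv.Perm (Fin n)) : Prop :=
  ∃ f : Fin k → Fin n, StrictMono f ∧ ∀ i j : Fin k, π i < π j ↔ σ (f i) < σ (f j)

/-- `σ` avoids the pattern `π`. -/
def AvoidsPat {n k : ℕ} (π : Fin k → Fin k) (σ : Equiv.Perm (Fin n)) : Prop :=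
  ¬ Contains π σ

/-- The descent set of `σ` (1-based positions `i ∈ [n-1]` with `σ(i) > σ(i+1)`). -/
def Des {n : ℕ} (σ : Equiv.Perm (Fin n)) : Finset ℕ :=
  (Finset.Icc 1 (n - 1)).filter (fun i => entry σ (i + 1) < entry σ i)

/-- The descent top set of `σ`: `{σ(i) : i ∈ Des σ}`. -/
def Destop {n : ℕ} (σ : Equiv.Perm (Fin n)) : Finset ℕ :=
  (Des σ).image (entry σ)

/-- The descent bottom set of `σ`: `{σ(i+1) : i ∈ Des σ}`. -/
def Desbot {n : ℕ} (σ : Equiv.Perm (Fin n)) : Finset ℕ :=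
  (Des σ).image (fun i => entry σ (i + 1))

/-- The ascent set of `σ` (1-based positions `i ∈ [n-1]` with `σ(i) < σ(i+1)`). -/
def Asc {n : ℕ} (σ : Equiv.Perm (Fin n)) : Finset ℕ :=
  (Finset.Icc 1 (n - 1)).filter (fun i => entry σ i < entry σ (i + 1))

/-- The ascent top set of `σ`: `{σ(i+1) : i ∈ Asc σ}`. -/
def Asctop {n : ℕ} (σ : Equiv.Perm (Fin n)) : Finset ℕ :=
  (Asc σ).image (fun i => entry σ (i + 1))

/-- The ascent bottom set of `σ`: `{σ(i) : i ∈ Asc σ}`. -/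
def Ascbot {n : ℕ} (σ : Equiv.Perm (Fin n)) : Finset ℕ :=
  (Asc σ).image (entry σ)

/-- The set of peak values of `σ`. -/
def Peak {n : ℕ} (σ : Equiv.Perm (Fin n)) : Finset ℕ :=
  Destop σ ∩ Asctop σ

/-- The set of valley values of `σ`. -/
def Val {n : ℕ} (σ : Equiv.Perm (Fin n)) : Finset ℕ :=
  Desbot σ ∩ Ascbot σ

/-- The set of left-to-right maxima (as values) of `σ`. -/
noncomputable def LRmax {n : ℕ} (σ : Equiv.Perm (Fin n)) : Finset ℕ :=
  ((Finset.Icc 1 n).filter (fun i => ∀ j, 1 ≤ j → j < i → entry σ j < entry σ i)).image (entry σ)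

/-- The set of left-to-right minima (as values) of `σ`. -/
noncomputable def LRmin {n : ℕ} (σ : Equiv.Perm (Fin n)) : Finset ℕ :=
  ((Finset.Icc 1 n).filter (fun i => ∀ j, 1 ≤ j → j < i → entry σ i < entry σ j)).image (entry σ)

/-- The set of right-to-left maxima (as values) of `σ`. -/
noncomputable def RLmax {n : ℕ} (σ : Equiv.Perm (Fin n)) : Finset ℕ :=
  ((Finset.Icc 1 n).filter (fun i => ∀ j, i < j → j ≤ n → entry σ j < entry σ i)).image (entry σ)

/-- The set of right-to-left minima (as values) of `σ`. -/
noncomputable def RLmin {n : ℕ} (σ : Equiv.Perm (Fin n)) : Finset ℕ :=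
  ((Finset.Icc 1 n).filter (fun i => ∀ j, i < j → j ≤ n → entry σ i < entry σ j)).image (entry σ)

/-- `(T, B)` is a descent matching: `T` and `B` are finite sets of positive integers
with `|T| = |B| = k`, and writing `T = {t_1 < … < t_k}`, `B = {b_1 < … < b_k}`,
we have `t_i > b_i` for all `i ∈ [k]`. -/
def DescentMatching (T B : Finset ℕ) : Prop :=
  T.card = B.card ∧ (∀ t ∈ T, 0 < t) ∧ (∀ b ∈ B, 0 < b) ∧
    ∀ i < T.card, (B.sort (· ≤ ·)).getD i 0 < (T.sort (· ≤ ·)).getD i 0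

/-- `(2_v 31)σ`: the number of occurrences of the vincular pattern `2-31` in `σ`
in which the "2" has value `v`. -/
def occ2_31at {n : ℕ} (σ : Equiv.Perm (Fin n)) (v : ℕ) : ℕ :=
  ((Finset.Icc 1 (n - 1) ×ˢ Finset.Icc 1 (n - 1)).filter
    (fun p => p.1 < p.2 ∧ entry σ (p.2 + 1) < entry σ p.2 ∧
      entry σ (p.2 + 1) < entry σ p.1 ∧ entry σ p.1 = v ∧ v < entry σ p.2)).card

/-- `(31 2_v)σ`: the number of occurrences of the vincular pattern `31-2` in `σ`
in which the "2" has value `v`. -/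
def occ31_2at {n : ℕ} (σ : Equiv.Perm (Fin n)) (v : ℕ) : ℕ :=
  ((Finset.Icc 1 (n - 1) ×ˢ Finset.Icc 1 n).filter
    (fun p => p.1 + 1 < p.2 ∧ entry σ (p.1 + 1) < entry σ p.1 ∧
      entry σ (p.1 + 1) < entry σ p.2 ∧ entry σ p.2 = v ∧ v < entry σ p.1)).card

/-- `(2-31)σ`: the number of occurrences of the vincular pattern `2-31` in `σ`. -/
def occ2_31 {n : ℕ} (σ : Equiv.Perm (Fin n)) : ℕ :=
  ((Finset.Icc 1 (n - 1) ×ˢ Finset.Icc 1 (n - 1)).filter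
    (fun p => p.1 < p.2 ∧ entry σ (p.2 + 1) < entry σ p.2 ∧
      entry σ (p.2 + 1) < entry σ p.1 ∧ entry σ p.1 < entry σ p.2)).card

/-- `(31-2)σ`: the number of occurrences of the vincular pattern `31-2` in `σ`. -/
def occ31_2 {n : ℕ} (σ : Equiv.Perm (Fin n)) : ℕ :=
  ((Finset.Icc 1 (n - 1) ×ˢ Finset.Icc 1 n).filter
    (fun p => p.1 + 1 < p.2 ∧ entry σ (p.1 + 1) < entry σ p.1 ∧
      entry σ (p.1 + 1) < entry σ p.2 ∧ entry σ p.2 < entry σ p.1)).card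

/-- The signature function `sg_{(T,B)}(i) = |B_{<i}| - |T_{≤i}| + 1`. -/
def sg (T B : Finset ℕ) (i : ℕ) : ℕ :=
  (B.filter (fun b => b < i)).card - (T.filter (fun t => t ≤ i)).card + 1

/-- The `(p,q)`-integer `[m]_{p,q} = Σ_{a+b=m-1} p^a q^b`. -/
def genQInt {R : Type*} [CommRing R] (m : ℕ) (p q : R) : R :=
  ∑ a ∈ Finset.range m, p ^ a * q ^ (m - 1 - a)

/-- The reverse complement of `σ`: `σ^{rc}(i) = n + 1 - σ(n + 1 - i)`. -/
def revComp {n : ℕ} (σ : Equiv.Perm (Fin n)) : Equiv.Perm (Fin n) :=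
  (Fin.revPerm.trans σ).trans Fin.revPerm

namespace Wilf

inductive K
  | l | s | e

/-- insertion of the value `w` at gap `p` of a word. -/
def ins (p w : ℕ) (f : ℕ → ℕ) : ℕ → ℕ :=
  fun k => if k < p then f k else if k = p then w else f (k - 1)

lemma ins_lt {p w : ℕ} {f : ℕ → ℕ} {k : ℕ} (h : k < p) : ins p w f k = f k := by
  simp [ins, h]
lemma ins_eq {p w : ℕ} {f : ℕ → ℕ} : ins p w f p = w := by
  simp [ins]
lemma ins_gt {p w : ℕ} {f : ℕ → ℕ} {k : ℕ} (h : p < k) : ins p w f k = f (k - 1) := by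
  have h1 : ¬ k < p := by omega
  have h2 : k ≠ p := by omega
  simp [ins, h1, h2]
lemma ins_succ {p w : ℕ} {f : ℕ → ℕ} {k : ℕ} (h : p ≤ k) : ins p w f (k + 1) = f k := by
  rw [ins_gt (by omega)]; rfl

/-- letters between gaps `i` and `j` are smaller than the letters after gap `j`. -/
def dom (m : ℕ) (f : ℕ → ℕ) (i j : ℕ) : Prop :=
  ∀ s t, i ≤ s → s < j → j ≤ t → t < m → f s < f t

lemma dom_ins {m p w : ℕ} {f : ℕ → ℕ} (hp : p ≤ m) (hw : ∀ k < m, w < f k) {x y : ℕ}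
    (hxy : x < y) :
    dom (m + 1) (ins p w f) x y ↔ p < y ∧ dom m f (if x ≤ p then x else x - 1) (y - 1) := by
  constructor
  · intro h
    have hpy : p < y := by
      by_contra hc
      have := h x p le_rfl hxy (by omega) (by omega)
      rw [ins_lt (by omega), ins_eq] at this
      have := hw x (by omega)
      omega
    refine ⟨hpy, ?_⟩
    intro s t h1 h2 h3 h4
    have ht : ins p w f (t + 1) = f t := ins_succ (by omega)
    by_cases hs : s < p
    · have := h s (t + 1) (by split_ifs at h1 <;> omega) (by omega) (by omega) (by omega)
      rwa [ht, ins_lt hs] at this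
    · have := h (s + 1) (t + 1) (by split_ifs at h1 <;> omega) (by omega) (by omega) (by omega)
      rwa [ht, ins_succ (by omega)] at this
  · rintro ⟨hpy, h⟩ s t h1 h2 h3 h4
    rw [ins_gt (k := t) (by omega)]
    rcases lt_trichotomy s p with hs | hs | hs
    · rw [ins_lt hs]
      exact h s (t - 1) (by split_ifs <;> omega) (by omega) (by omega) (by omega)
    · subst hs
      rw [ins_eq]
      exact hw _ (by omega)
    · rw [ins_gt hs]
      exact h (s - 1) (t - 1) (by split_ifs <;> omega) (by omega) (by omega) (by omega)

def used (T A : Finset ℕ) (m : ℕ) (f : ℕ → ℕ) : Prop :=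
  ∀ k, k + 1 < m → (f (k + 1) < f k → f k ∈ T) ∧ (f k < f (k + 1) → f (k + 1) ∈ A)

def rl (R : Finset ℕ) (m : ℕ) (f : ℕ → ℕ) : Prop :=
  ∀ k < m, (f k ∈ R ↔ ∀ j, k < j → j < m → f j < f k)

/-- avoidance: `b = true` for 1423, `b = false` for 2413. -/
def av (b : Bool) (m : ℕ) (f : ℕ → ℕ) : Prop :=
  ∀ i j k t, i < j → j < k → k < t → t < m →
    if b = true then ¬ (f i < f k ∧ f k < f t ∧ f t < f j)
    else ¬ (f k < f i ∧ f i < f t ∧ f t < f j)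

def mark (T A : Finset ℕ) (m : ℕ) (f : ℕ → ℕ) (p : ℕ) : Prop :=
  if m = 0 then True else if p = 0 then f 0 ∈ A else if p = m then f (m - 1) ∈ T
  else if f p < f (p - 1) then f p ∈ A else f (p - 1) ∈ T

def active (b : Bool) (m : ℕ) (f : ℕ → ℕ) (p : ℕ) : Prop :=
  if b = true then ∀ j k t, p ≤ j → j < k → k < t → t < m → ¬ (f k < f t ∧ f t < f j)
  else ∀ i j t, i < j → j < p → p ≤ t → t < m → ¬ (f i < f t ∧ f t < f j)

def insCond (T A : Finset ℕ) (b : Bool) (m : ℕ) (f : ℕ → ℕ) (p : ℕ) : Prop :=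
  if b = true then ∀ j ≤ m, mark T A m f j → j < p → dom m f j p
  else ∀ j ≤ m, mark T A m f j → p < j → dom m f p j

structure Viable (T A R : Finset ℕ) (b : Bool) (m : ℕ) (f : ℕ → ℕ) : Prop where
  used : used T A m f
  rl : rl R m f
  av : av b m f
  act : ∀ p ≤ m, mark T A m f p → active b m f p

lemma mark_lt {T A : Finset ℕ} {m p w q : ℕ} {f : ℕ → ℕ} (hp : p ≤ m) (hq : q < p) :
    mark T A (m + 1) (ins p w f) q ↔ mark T A m f q := by
  unfold mark
  have h1 : m ≠ 0 := by omega
  have h2 : q ≠ m + 1 := by omega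
  have h3 : q ≠ m := by omega
  have h4 : m + 1 ≠ 0 := by omega
  simp only [h1, h2, h3, h4, if_false]
  by_cases h0 : q = 0
  · subst h0; simp [ins_lt hq]
  · simp only [h0, if_false]
    rw [ins_lt hq, ins_lt (by omega)]

lemma mark_gt {T A : Finset ℕ} {m p w q : ℕ} {f : ℕ → ℕ} (hp : p < q) (hq : q ≤ m) :
    mark T A (m + 1) (ins p w f) (q + 1) ↔ mark T A m f q := by
  unfold mark
  have h1 : m ≠ 0 := by omega
  have h2 : q ≠ 0 := by omega
  have h4 : m + 1 ≠ 0 := by omega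
  have h5 : q + 1 ≠ 0 := by omega
  have h6 : m + 1 - 1 = (m - 1) + 1 := by omega
  have h7 : q + 1 - 1 = (q - 1) + 1 := by omega
  simp only [h1, h2, h4, h5, if_false, h6, h7]
  rw [ins_succ (by omega), ins_succ (by omega), ins_succ (by omega)]
  simp

lemma mark_eq {T A : Finset ℕ} {m p w : ℕ} {f : ℕ → ℕ} (hp : p ≤ m) (hw : ∀ k < m, w < f k) :
    mark T A (m + 1) (ins p w f) p ↔ w ∈ A := by
  unfold mark
  have h2 : p ≠ m + 1 := by omega
  have h4 : m + 1 ≠ 0 := by omega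
  simp only [h2, h4, if_false]
  by_cases h0 : p = 0
  · subst h0; simp [ins_eq]
  · have := hw (p - 1) (by omega)
    rw [ins_eq, ins_lt (k := p - 1) (by omega)]
    simp [h0, this]

lemma mark_succ {T A : Finset ℕ} {m p w : ℕ} {f : ℕ → ℕ} (hp : p ≤ m) (hw : ∀ k < m, w < f k) :
    mark T A (m + 1) (ins p w f) (p + 1) ↔ w ∈ T := by
  unfold mark
  have h4 : m + 1 ≠ 0 := by omega
  have h5 : p + 1 ≠ 0 := by omega
  simp only [h4, h5, if_false]
  by_cases h0 : p = m
  · subst h0; simp [ins_eq]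
  · have := hw p (by omega)
    rw [ins_succ le_rfl]
    have h6 : p + 1 - 1 = p := by omega
    rw [h6, ins_eq]
    have h7 : ¬ f p < w := by omega
    simp [h0, h7]

lemma used_ins {T A : Finset ℕ} {m p w : ℕ} {f : ℕ → ℕ} (hp : p ≤ m) (hw : ∀ k < m, w < f k)
    (hinj : ∀ i < m, ∀ j < m, f i = f j → i = j) :
    used T A (m + 1) (ins p w f) ↔ used T A m f ∧ mark T A m f p := by
  have key : used T A (m + 1) (ins p w f) ↔
      ((∀ k, k + 1 < m → k + 1 ≠ p →
        (f (k + 1) < f k → f k ∈ T) ∧ (f k < f (k + 1) → f (k + 1) ∈ A)) ∧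
        (0 < p → f (p - 1) ∈ T) ∧ (p < m → f p ∈ A)) := by
    constructor
    · intro h
      refine ⟨?_, ?_, ?_⟩
      · intro k hk hkp
        by_cases hlt : k + 1 < p
        · have := h k (by omega)
          rwa [ins_lt hlt, ins_lt (by omega)] at this
        · have := h (k + 1) (by omega)
          rwa [ins_succ (by omega), ins_succ (by omega)] at this
      · intro h0
        have := (h (p - 1) (by omega)).1
        rw [Nat.sub_add_cancel h0, ins_eq, ins_lt (by omega)] at this
        exact this (hw _ (by omega))
      · intro h0
        have := (h p (by omega)).2
        rw [ins_succ le_rfl, ins_eq] at this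
        exact this (hw _ (by omega))
    · rintro ⟨h1, h2, h3⟩ k hk
      rcases lt_trichotomy (k + 1) p with h | h | h
      · rw [ins_lt h, ins_lt (by omega)]
        exact h1 k (by omega) (by omega)
      · subst h
        rw [ins_eq, ins_lt (by omega)]
        have := hw k (by omega)
        exact ⟨fun _ => h2 (by omega), fun h => by omega⟩
      · rcases Nat.lt_or_ge p k with h' | h'
        · obtain ⟨k, rfl⟩ : ∃ k', k = k' + 1 := ⟨k - 1, by omega⟩
          rw [ins_succ (by omega), ins_succ (by omega)]
          exact h1 k (by omega) (by omega)
        · have : k = p := by omega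
          subst this
          rw [ins_succ le_rfl, ins_eq]
          have := hw k (by omega)
          exact ⟨fun h => by omega, fun _ => h3 (by omega)⟩
  rw [key]
  constructor
  · rintro ⟨h1, h2, h3⟩
    refine ⟨?_, ?_⟩
    · intro k hk
      by_cases hkp : k + 1 = p
      · subst hkp
        exact ⟨fun _ => h2 (by omega), fun _ => h3 (by omega)⟩
      · exact h1 k hk hkp
    · unfold mark
      split_ifs with a1 a2 a3 a4
      · subst a2; exact h3 (by omega)
      · subst a3; exact h2 (by omega)
      · exact h3 (by omega)
      · exact h2 (by omega)
  · rintro ⟨h1, h2⟩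
    refine ⟨fun k hk _ => h1 k hk, ?_, ?_⟩
    · intro h0
      unfold mark at h2
      split_ifs at h2 with a1 a2 a3 a4
      · omega
      · omega
      · subst a3; exact h2
      · have := (h1 (p - 1) (by omega)).1
        rw [Nat.sub_add_cancel h0] at this
        exact this a4
      · exact h2
    · intro h0
      unfold mark at h2
      split_ifs at h2 with a1 a2 a3 a4
      · omega
      · subst a2; exact h2
      · omega
      · exact h2
      · have := (h1 (p - 1) (by omega)).2
        rw [Nat.sub_add_cancel (by omega)] at this
        refine this ?_
        rcases lt_trichotomy (f (p - 1)) (f p) with h | h | h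
        · exact h
        · have := hinj _ (by omega) _ (by omega) h
          omega
        · exact absurd h a4

lemma rl_ins {R : Finset ℕ} {m p w : ℕ} {f : ℕ → ℕ} (hp : p ≤ m) (hw : ∀ k < m, w < f k) :
    rl R (m + 1) (ins p w f) ↔ rl R m f ∧ (w ∈ R ↔ p = m) := by
  have e1 : ∀ k < m, ∀ k', (k' = if k < p then k else k + 1) →
      ((∀ j, k' < j → j < m + 1 → ins p w f j < ins p w f k') ↔
        (∀ j, k < j → j < m → f j < f k)) := by
    intro k hk k' hk'
    have hf : ins p w f k' = f k := by
      split_ifs at hk' with h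
      · rw [hk', ins_lt h]
      · rw [hk', ins_succ (by omega)]
    rw [hf]
    constructor
    · intro h j h1 h2
      by_cases hj : j < p
      · have := h j (by split_ifs at hk' <;> omega) (by omega)
        rwa [ins_lt hj] at this
      · have := h (j + 1) (by split_ifs at hk' <;> omega) (by omega)
        rwa [ins_succ (by omega)] at this
    · intro h j h1 h2
      rcases lt_trichotomy j p with hj | hj | hj
      · rw [ins_lt hj]; exact h j (by split_ifs at hk' <;> omega) (by omega)
      · subst hj; rw [ins_eq]; exact hw k hk
      · rw [ins_gt hj]; exact h (j - 1) (by split_ifs at hk' <;> omega) (by omega)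
  have e2 : (∀ j, p < j → j < m + 1 → ins p w f j < ins p w f p) ↔ p = m := by
    constructor
    · intro h
      by_contra hc
      have := h (p + 1) (by omega) (by omega)
      rw [ins_succ le_rfl, ins_eq] at this
      have := hw p (by omega)
      omega
    · intro h j h1 h2; omega
  constructor
  · intro h
    refine ⟨?_, ?_⟩
    · intro k hk
      rw [← e1 k hk _ rfl, ← h _ (by split_ifs <;> omega)]
      split_ifs with hh
      · rw [ins_lt hh]
      · rw [ins_succ (by omega)]
    · rw [← e2, ← h p (by omega), ins_eq]
  · rintro ⟨h1, h2⟩ k hk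
    rcases lt_trichotomy k p with hj | hj | hj
    · rw [e1 k (by omega) k (by simp [hj]), ← h1 k (by omega), ins_lt hj]
    · subst hj; rw [e2, ins_eq, h2]
    · rw [e1 (k - 1) (by omega) k (by split_ifs <;> omega), ← h1 _ (by omega), ins_gt hj]

lemma act_le {b : Bool} {m p w q : ℕ} {f : ℕ → ℕ} (hp : p ≤ m) (hw : ∀ k < m, w < f k)
    (hinj : ∀ i < m, ∀ j < m, f i = f j → i = j) (hq : q ≤ p) :
    active b (m + 1) (ins p w f) q ↔ active b m f q ∧ (b = true → dom m f q p) := by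
  cases b
  · simp only [active, Bool.false_eq_true, if_false, false_implies, and_true]
    constructor
    · intro h i j t h1 h2 h3 h4
      by_cases ht : t < p
      · have := h i j t h1 h2 h3 (by omega)
        rwa [ins_lt ht, ins_lt (by omega), ins_lt (by omega)] at this
      · have := h i j (t + 1) h1 h2 (by omega) (by omega)
        rwa [ins_succ (by omega), ins_lt (by omega), ins_lt (by omega)] at this
    · intro h i j t h1 h2 h3 h4
      rw [ins_lt (k := i) (by omega), ins_lt (k := j) (by omega)]
      rcases lt_trichotomy t p with ht | ht | ht
      · rw [ins_lt ht]; exact h i j t h1 h2 h3 (by omega)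
      · subst ht; rw [ins_eq]
        have := hw i (by omega)
        omega
      · rw [ins_gt ht]; exact h i j (t - 1) h1 h2 (by omega) (by omega)
  · simp only [active, if_true, true_implies]
    constructor
    · intro h
      refine ⟨?_, ?_⟩
      · intro j k t h1 h2 h3 h4
        have := h (if j < p then j else j + 1) (if k < p then k else k + 1)
          (if t < p then t else t + 1) (by split_ifs <;> omega) (by split_ifs <;> omega)
          (by split_ifs <;> omega) (by split_ifs <;> omega)
        have e : ∀ x, ins p w f (if x < p then x else x + 1) = f x := by
          intro x; split_ifs with hx
          · exact ins_lt hx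
          · exact ins_succ (by omega)
        rwa [e, e, e] at this
      · intro s t h1 h2 h3 h4
        have := h s p (t + 1) h1 h2 (by omega) (by omega)
        rw [ins_eq, ins_lt h2, ins_succ h3] at this
        have h5 := hw t h4
        have h6 : f s ≠ f t := fun hh => by
          have := hinj s (by omega) t h4 hh
          omega
        omega
    · rintro ⟨h, hd⟩ j k t h1 h2 h3 h4
      by_cases hj : j = p
      · subst hj
        rw [ins_eq, ins_gt (k := t) (by omega)]
        have := hw (t - 1) (by omega)
        omega
      by_cases ht : t = p
      · subst ht
        rw [ins_eq, ins_lt (k := k) (by omega)]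
        have := hw k (by omega)
        omega
      by_cases hk : k = p
      · subst hk
        rw [ins_eq, ins_lt (k := j) (by omega), ins_gt (k := t) (by omega)]
        have := hd j (t - 1) h1 (by omega) (by omega) (by omega)
        omega
      have e : ∀ x, x ≠ p → ins p w f x = f (if x < p then x else x - 1) := by
        intro x hx; split_ifs with hh
        · exact ins_lt hh
        · exact ins_gt (by omega)
      rw [e _ hj, e _ hk, e _ ht]
      exact h _ _ _ (by split_ifs <;> omega) (by split_ifs <;> omega)
          (by split_ifs <;> omega) (by split_ifs <;> omega)

lemma act_gt {b : Bool} {m p w q : ℕ} {f : ℕ → ℕ} (hp : p ≤ m) (hw : ∀ k < m, w < f k)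
    (hinj : ∀ i < m, ∀ j < m, f i = f j → i = j) (hq : p ≤ q) (hqm : q ≤ m) :
    active b (m + 1) (ins p w f) (q + 1) ↔ active b m f q ∧ (b = false → dom m f p q) := by
  cases b
  · simp only [active, Bool.false_eq_true, if_false, true_implies]
    constructor
    · intro h
      refine ⟨?_, ?_⟩
      · intro j k t h1 h2 h3 h4
        have := h (if j < p then j else j + 1) (if k < p then k else k + 1)
          (if t < p then t else t + 1) (by split_ifs <;> omega) (by split_ifs <;> omega)
          (by split_ifs <;> omega) (by split_ifs <;> omega)
        have e : ∀ x, ins p w f (if x < p then x else x + 1) = f x := by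
          intro x; split_ifs with hx
          · exact ins_lt hx
          · exact ins_succ (by omega)
        rwa [e, e, e] at this
      · intro s t h1 h2 h3 h4
        have := h p (s + 1) (t + 1) (by omega) (by omega) (by omega) (by omega)
        rw [ins_eq, ins_succ h1, ins_succ (by omega)] at this
        have h5 := hw t h4
        have h6 : f s ≠ f t := fun hh => by
          have := hinj s (by omega) t h4 hh
          omega
        omega
    · rintro ⟨h, hd⟩ i j t h1 h2 h3 h4
      rw [ins_gt (k := t) (by omega)]
      by_cases hj : j = p
      · subst hj
        rw [ins_eq]
        have := hw (t - 1) (by omega)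
        omega
      by_cases hi : i = p
      · subst hi
        rw [ins_eq, ins_gt (k := j) (by omega)]
        have := hd (j - 1) (t - 1) (by omega) (by omega) (by omega) (by omega)
        omega
      have e : ∀ x, x ≠ p → ins p w f x = f (if x < p then x else x - 1) := by
        intro x hx; split_ifs with hh
        · exact ins_lt hh
        · exact ins_gt (by omega)
      rw [e _ hj, e _ hi]
      exact h _ _ _ (by split_ifs <;> omega) (by split_ifs <;> omega)
          (by omega) (by omega)
  · simp only [active, if_true, Bool.true_eq_false, false_implies, and_true]
    constructor
    · intro h i j t h1 h2 h3 h4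
      have := h (i + 1) (j + 1) (t + 1) (by omega) (by omega) (by omega) (by omega)
      rwa [ins_succ (by omega), ins_succ (by omega), ins_succ (by omega)] at this
    · intro h i j t h1 h2 h3 h4
      rw [ins_gt (k := i) (by omega), ins_gt (k := j) (by omega), ins_gt (k := t) (by omega)]
      exact h _ _ _ (by omega) (by omega) (by omega) (by omega)

lemma av_ins {b : Bool} {m p w : ℕ} {f : ℕ → ℕ} (hp : p ≤ m) (hw : ∀ k < m, w < f k) :
    av b (m + 1) (ins p w f) ↔ av b m f ∧ active b m f p := by
  have e : ∀ x, ins p w f (if x < p then x else x + 1) = f x := by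
    intro x; split_ifs with hx
    · exact ins_lt hx
    · exact ins_succ (by omega)
  have e' : ∀ x, x ≠ p → ins p w f x = f (if x < p then x else x - 1) := by
    intro x hx; split_ifs with hh
    · exact ins_lt hh
    · exact ins_gt (by omega)
  have hw' : ∀ x ≤ m, w ≤ ins p w f x := by
    intro x hx
    by_cases h : x = p
    · subst h; rw [ins_eq]
    · rw [e' x h]; exact (hw _ (by split_ifs <;> omega)).le
  constructor
  · intro h
    refine ⟨?_, ?_⟩
    · intro i j k t h1 h2 h3 h4
      have := h (if i < p then i else i + 1) (if j < p then j else j + 1)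
        (if k < p then k else k + 1)
        (if t < p then t else t + 1) (by split_ifs <;> omega) (by split_ifs <;> omega)
        (by split_ifs <;> omega) (by split_ifs <;> omega)
      rwa [e, e, e, e] at this
    · cases b
      · simp only [active, Bool.false_eq_true, if_false]
        intro i j t h1 h2 h3 h4
        have := h i j p (t + 1) h1 h2 (by omega) (by omega)
        simp only [Bool.false_eq_true, if_false] at this
        rw [ins_eq, ins_lt h2, ins_succ h3, ins_lt (by omega)] at this
        have := hw i (by omega)
        omega
      · simp only [active, if_true]
        intro j k t h1 h2 h3 h4
        have := h p (j + 1) (k + 1) (t + 1) (by omega) (by omega) (by omega) (by omega)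
        simp only [if_true] at this
        rw [ins_eq, ins_succ (by omega), ins_succ (by omega), ins_succ (by omega)] at this
        have := hw k (by omega)
        omega
  · rintro ⟨h, ha⟩ i j k t h1 h2 h3 h4
    by_cases hh : i ≠ p ∧ j ≠ p ∧ k ≠ p ∧ t ≠ p
    · rw [e' _ hh.1, e' _ hh.2.1, e' _ hh.2.2.1, e' _ hh.2.2.2]
      have a1 := hh.1
      have a2 := hh.2.1
      have a3 := hh.2.2.1
      have a4 := hh.2.2.2
      exact h _ _ _ _ (by split_ifs <;> omega) (by split_ifs <;> omega)
        (by split_ifs <;> omega) (by split_ifs <;> omega)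
    · have b1 := hw' i (by omega)
      have b2 := hw' j (by omega)
      have b3 := hw' k (by omega)
      have b4 := hw' t (by omega)
      cases b
      · simp only [Bool.false_eq_true, if_false]
        simp only [active, Bool.false_eq_true, if_false] at ha
        by_cases hk : k = p
        · subst hk
          have := ha i j (t - 1) h1 h2 (by omega) (by omega)
          rw [ins_lt (k := i) (by omega), ins_lt (k := j) (by omega),
            ins_gt (k := t) (by omega)]
          omega
        · have : ins p w f i = w ∨ ins p w f j = w ∨ ins p w f t = w := by
            by_cases c1 : i = p
            · left; rw [c1, ins_eq]
            by_cases c2 : j = p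
            · right; left; rw [c2, ins_eq]
            by_cases c3 : t = p
            · right; right; rw [c3, ins_eq]
            exact absurd ⟨c1, c2, hk, c3⟩ hh
          omega
      · simp only [if_true]
        simp only [active, if_true] at ha
        by_cases hk : i = p
        · subst hk
          have := ha (j - 1) (k - 1) (t - 1) (by omega) (by omega) (by omega) (by omega)
          rw [ins_gt (k := k) (by omega), ins_gt (k := j) (by omega),
            ins_gt (k := t) (by omega)]
          omega
        · have : ins p w f k = w ∨ ins p w f j = w ∨ ins p w f t = w := by
            by_cases c1 : k = p
            · left; rw [c1, ins_eq]
            by_cases c2 : j = p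
            · right; left; rw [c2, ins_eq]
            by_cases c3 : t = p
            · right; right; rw [c3, ins_eq]
            exact absurd ⟨hk, c2, c1, c3⟩ hh
          omega

lemma viable_ins {T A R : Finset ℕ} {b : Bool} {m p w : ℕ} {f : ℕ → ℕ} (hp : p ≤ m)
    (hw : ∀ k < m, w < f k) (hinj : ∀ i < m, ∀ j < m, f i = f j → i = j) :
    Viable T A R b (m + 1) (ins p w f) ↔ Viable T A R b m f ∧ mark T A m f p ∧
      (w ∈ R ↔ p = m) ∧ insCond T A b m f p := by
  constructor
  · rintro ⟨h1, h2, h3, h4⟩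
    rw [used_ins hp hw hinj] at h1
    rw [rl_ins hp hw] at h2
    rw [av_ins hp hw] at h3
    refine ⟨⟨h1.1, h2.1, h3.1, ?_⟩, h1.2, h2.2, ?_⟩
    · intro q hq hm
      rcases lt_trichotomy q p with h | h | h
      · have := h4 q (by omega) ((mark_lt hp h).2 hm)
        exact ((act_le hp hw hinj h.le).1 this).1
      · subst h; exact h3.2
      · have := h4 (q + 1) (by omega) ((mark_gt h hq).2 hm)
        exact ((act_gt hp hw hinj h.le hq).1 this).1
    · cases b
      · simp only [insCond, Bool.false_eq_true, if_false]
        intro q hq hm h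
        have := h4 (q + 1) (by omega) ((mark_gt h hq).2 hm)
        exact ((act_gt hp hw hinj h.le hq).1 this).2 rfl
      · simp only [insCond, if_true]
        intro q hq hm h
        have := h4 q (by omega) ((mark_lt hp h).2 hm)
        exact ((act_le hp hw hinj h.le).1 this).2 rfl
  · rintro ⟨⟨h1, h2, h3, h4⟩, hm, hr, hc⟩
    refine ⟨(used_ins hp hw hinj).2 ⟨h1, hm⟩, (rl_ins hp hw).2 ⟨h2, hr⟩,
      (av_ins hp hw).2 ⟨h3, h4 p hp hm⟩, ?_⟩
    intro q hq hmq
    have hd : ∀ b', b' = b → dom m f p p := by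
      intro _ _ s t a1 a2; omega
    rcases le_or_gt q p with h | h
    · rw [act_le hp hw hinj h]
      rcases h.eq_or_lt with h | h
      · subst h; exact ⟨h4 q hp hm, fun hb => hd _ hb.symm⟩
      · have hm' := (mark_lt hp h).1 hmq
        refine ⟨h4 q (by omega) hm', fun hb => ?_⟩
        subst hb
        simp only [insCond, if_true] at hc
        exact hc q (by omega) hm' h
    · obtain ⟨q, rfl⟩ : ∃ q', q = q' + 1 := ⟨q - 1, by omega⟩
      rw [act_gt hp hw hinj (by omega) (by omega)]
      rcases (show p ≤ q by omega).eq_or_lt with h | h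
      · subst h; exact ⟨h4 p hp hm, fun hb => hd _ hb.symm⟩
      · have hm' := (mark_gt h (by omega)).1 hmq
        refine ⟨h4 q (by omega) hm', fun hb => ?_⟩
        subst hb
        simp only [insCond, Bool.false_eq_true, if_false] at hc
        exact hc q (by omega) hm' h

/-- relation between consecutive (in the enumeration order) marked gaps -/
def Rel (b : Bool) (m : ℕ) (f : ℕ → ℕ) (x y : ℕ × K) : Prop :=
  (y.2 ≠ K.l → x.1 < y.1 ∧ dom m f x.1 y.1) ∧
  (y.2 = K.l → if b = true then x.1 < y.1 ∧ ¬ dom m f x.1 y.1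
    else y.1 < x.1 ∧ ¬ dom m f y.1 x.1)

structure PreEnum (T A : Finset ℕ) (b : Bool) (m : ℕ) (f : ℕ → ℕ) (Z : List (ℕ × K)) : Prop where
  pw : Z.Pairwise (Rel b m f)
  mem : ∀ q, (q ≤ m ∧ mark T A m f q) ↔ ∃ c, (q, c) ∈ Z
  e : ∀ z ∈ Z, (z.2 = K.e ↔ z.1 = m)

structure Enum (T A : Finset ℕ) (b : Bool) (m : ℕ) (f : ℕ → ℕ) (Z : List (ℕ × K)) : Prop
    extends PreEnum T A b m f Z where
  head : ∀ z Z', Z = z :: Z' → z.2 ≠ K.l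

def fixHead : List K → List K
  | K.l :: t => K.s :: t
  | u => u

def fixZ : List (ℕ × K) → List (ℕ × K)
  | (q, K.l) :: t => (q, K.s) :: t
  | u => u

lemma fixZ_map (Z : List (ℕ × K)) : (fixZ Z).map Prod.snd = fixHead (Z.map Prod.snd) := by
  match Z with
  | [] => rfl
  | (q, K.l) :: t => rfl
  | (q, K.s) :: t => rfl
  | (q, K.e) :: t => rfl

lemma PreEnum.fix {T A : Finset ℕ} {b : Bool} {m : ℕ} {f : ℕ → ℕ} {Z : List (ℕ × K)}
    (h : PreEnum T A b m f Z) : Enum T A b m f (fixZ Z) := by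
  match Z, h with
  | [], h => exact ⟨h, by rintro z Z' ⟨⟩⟩
  | (q, K.s) :: t, h => exact ⟨h, by rintro z Z' ⟨⟩; simp⟩
  | (q, K.e) :: t, h => exact ⟨h, by rintro z Z' ⟨⟩; simp⟩
  | (q, K.l) :: t, h =>
    refine ⟨⟨?_, ?_, ?_⟩, ?_⟩
    · have := h.pw
      simp only [fixZ, List.pairwise_cons] at this ⊢
      exact ⟨fun y hy => this.1 y hy, this.2⟩
    · intro x
      rw [h.mem]
      simp only [fixZ, List.mem_cons, Prod.mk.injEq]
      constructor
      · rintro ⟨c, ⟨rfl, rfl⟩ | hc⟩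
        · exact ⟨_, Or.inl ⟨rfl, rfl⟩⟩
        · exact ⟨_, Or.inr hc⟩
      · rintro ⟨c, ⟨rfl, rfl⟩ | hc⟩
        · exact ⟨_, Or.inl ⟨rfl, rfl⟩⟩
        · exact ⟨_, Or.inr hc⟩
    · intro z hz
      simp only [fixZ, List.mem_cons] at hz
      rcases hz with rfl | hz
      · have := h.e (q, K.l) (by simp)
        simpa using this
      · exact h.e z (by simp [hz])
    · rintro z Z' ⟨⟩; simp

lemma Rel.ne {b : Bool} {m : ℕ} {f : ℕ → ℕ} {x y : ℕ × K} (h : Rel b m f x y) : x.1 ≠ y.1 := by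
  by_cases hy : y.2 = K.l
  · have := h.2 hy
    split_ifs at this <;> omega
  · have := (h.1 hy).1
    omega

lemma PreEnum.nodup {T A : Finset ℕ} {b : Bool} {m : ℕ} {f : ℕ → ℕ} {Z : List (ℕ × K)}
    (h : PreEnum T A b m f Z) : (Z.map Prod.fst).Nodup := by
  rw [List.Nodup, List.pairwise_map]
  exact h.pw.imp (fun h => h.ne)

lemma Enum.insCond_iff {T A : Finset ℕ} {b : Bool} {m : ℕ} {f : ℕ → ℕ} {Z1 Z2 : List (ℕ × K)}
    {p : ℕ} {c : K} (h : Enum T A b m f (Z1 ++ (p, c) :: Z2)) :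
    insCond T A b m f p ↔ c ≠ K.l := by
  have hpw := h.pw
  rw [List.pairwise_append, List.pairwise_cons] at hpw
  obtain ⟨-, ⟨h2, -⟩, h3⟩ := hpw
  have h1 : ∀ x ∈ Z1, Rel b m f x (p, c) := fun x hx => h3 x hx _ (by simp)
  constructor
  · intro hc hcl
    subst hcl
    cases Z1 with
    | nil => exact h.head _ _ rfl rfl
    | cons x t =>
      have hr := (h1 x (by simp)).2 rfl
      have hx := (h.mem x.1).2 ⟨x.2, by simp⟩
      cases b
      · simp only [Bool.false_eq_true, if_false] at hr
        simp only [insCond, Bool.false_eq_true, if_false] at hc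
        exact hr.2 (hc _ hx.1 hx.2 hr.1)
      · simp only [if_true] at hr
        simp only [insCond, if_true] at hc
        exact hr.2 (hc _ hx.1 hx.2 hr.1)
  · intro hc
    have key : ∀ j ≤ m, mark T A m f j → (j < p ∧ dom m f j p) ∨ j = p ∨
        (p < j ∧ (b = false → dom m f p j)) ∨ (b = false ∧ j < p) := by
      intro j hj hm
      obtain ⟨c', hc'⟩ := (h.mem j).1 ⟨hj, hm⟩
      rw [List.mem_append, List.mem_cons] at hc'
      rcases hc' with hc' | hc' | hc'
      · left; exact (h1 _ hc').1 hc
      · right; left; exact congrArg Prod.fst hc'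
      · right; right
        have := h2 _ hc'
        by_cases hl : c' = K.l
        · have := this.2 hl
          cases b
          · right; simp only [Bool.false_eq_true, if_false] at this
            exact ⟨rfl, this.1⟩
          · left; simp only [if_true] at this
            exact ⟨this.1, by simp⟩
        · have := this.1 hl
          exact Or.inl ⟨this.1, fun _ => this.2⟩
    cases b
    · simp only [insCond, Bool.false_eq_true, if_false]
      intro j hj hm hlt
      rcases key j hj hm with h | h | h | h
      · omega
      · omega
      · exact h.2 rfl
      · omega
    · simp only [insCond, if_true]
      intro j hj hm hlt
      rcases key j hj hm with h | h | h | h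
      · exact h.2
      · omega
      · omega
      · exact absurd h.1 (by simp)

lemma exists_sorted (b : Bool) (F : Finset ℕ) : ∃ L : List ℕ, L.length = F.card ∧
    (∀ x, x ∈ L ↔ x ∈ F) ∧ L.Pairwise (fun x y => if b = true then x < y else y < x) := by
  cases b
  · refine ⟨(F.sort (· ≤ ·)).reverse, by simp, by simp, ?_⟩
    rw [List.pairwise_reverse]
    simpa using (Finset.sortedLT_sort F).pairwise
  · refine ⟨F.sort (· ≤ ·), by simp, by simp, ?_⟩
    simpa using (Finset.sortedLT_sort F).pairwise

def sh (p q : ℕ) : ℕ := if q < p then q else q + 1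

lemma Enum.step {T A : Finset ℕ} {b : Bool} {m : ℕ} {f : ℕ → ℕ} {Z1 Z2 : List (ℕ × K)}
    {p w : ℕ} {c : K} (h : Enum T A b m f (Z1 ++ (p, c) :: Z2)) (hc : c ≠ K.l)
    (hw : ∀ k < m, w < f k) :
    ∃ Z', Enum T A b (m + 1) (ins p w f) Z' ∧ Z'.map Prod.snd =
      fixHead (List.replicate (Z1.length + if w ∈ A then 1 else 0) K.l ++
        (if w ∈ T then [c] else []) ++ Z2.map Prod.snd) := by
  have hpw := h.pw
  rw [List.pairwise_append, List.pairwise_cons] at hpw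
  obtain ⟨-, ⟨h2, h22⟩, h3⟩ := hpw
  have h1 : ∀ x ∈ Z1, x.1 < p ∧ dom m f x.1 p := fun x hx => (h3 x hx (p, c) (by simp)).1 hc
  have h12 : ∀ x ∈ Z1, ∀ y ∈ Z2, Rel b m f x y := fun x hx y hy => h3 x hx y (by simp [hy])
  have hp : p ≤ m := ((h.mem p).2 ⟨c, by simp⟩).1
  have hpp : dom m f p p := by intro s t a1 a2; omega
  have hm2 : ∀ y ∈ Z2, y.1 ≤ m := fun y hy => ((h.mem y.1).2 ⟨y.2, by simp [hy]⟩).1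
  have hnd := h.nodup
  have hnd1 : (Z1.map Prod.fst).Nodup := by
    rw [List.map_append] at hnd
    exact hnd.of_append_left
  set F : Finset ℕ := (Z1.map Prod.fst).toFinset ∪ (if w ∈ A then {p} else ∅) with hF
  have hFmem : ∀ x, x ∈ F ↔ (∃ c, (x, c) ∈ Z1) ∨ (w ∈ A ∧ x = p) := by
    intro x
    rw [hF, Finset.mem_union]
    by_cases hA : w ∈ A <;> simp [hA]
  have hFcard : F.card = Z1.length + if w ∈ A then 1 else 0 := by
    rw [hF, Finset.card_union_of_disjoint, List.toFinset_card_of_nodup hnd1]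
    · by_cases hA : w ∈ A <;> simp [hA]
    · by_cases hA : w ∈ A
      · simp only [hA, if_true, Finset.disjoint_singleton_right, List.mem_toFinset, List.mem_map]
        rintro ⟨x, hx, hxp⟩
        have := (h1 x hx).1
        omega
      · simp [hA]
  have hFle : ∀ x ∈ F, x ≤ p ∧ dom m f x p ∧ (∀ y ∈ Z2, Rel b m f (x, c) y) := by
    intro x hx
    rcases (hFmem x).1 hx with ⟨c', hx⟩ | ⟨-, rfl⟩
    · exact ⟨(h1 _ hx).1.le, (h1 _ hx).2, fun y hy => h12 _ hx y hy⟩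
    · exact ⟨le_rfl, hpp, h2⟩
  obtain ⟨L, hL1, hL2, hL3⟩ := exists_sorted b F
  have notdom : ∀ x y, x < y → y ≤ p → ¬ dom (m + 1) (ins p w f) x y := by
    intro x y hxy hyp
    rw [dom_ins hp hw hxy]
    omega
  -- relation of elements x ≤ p with the shifted elements
  have relZ2 : ∀ x ≤ p + 1, ∀ x0 ≤ p, (x0 = if x ≤ p then x else x - 1) → dom m f x0 p →
      ∀ c0 c1, ∀ y ∈ Z2, Rel b m f (x0, c0) y →
        Rel b (m + 1) (ins p w f) (x, c1) (sh p y.1, y.2) := by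
    intro x hx x0 hx0 hxx hd c0 c1 y hy hr
    have hpy := h2 y hy
    constructor
    · intro hy2
      have a1 := hr.1 hy2
      have a2 := hpy.1 hy2
      dsimp only at a1 a2 ⊢
      have : sh p y.1 = y.1 + 1 := by unfold sh; split_ifs <;> omega
      rw [this]
      refine ⟨by omega, ?_⟩
      rw [dom_ins hp hw (by omega), ← hxx]
      exact ⟨by omega, a1.2⟩
    · intro hy2
      have a1 := hr.2 hy2
      have a2 := hpy.2 hy2
      dsimp only at a1 a2 ⊢
      cases b
      · simp only [Bool.false_eq_true, if_false] at a1 a2 ⊢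
        have : sh p y.1 = y.1 := by unfold sh; split_ifs <;> omega
        rw [this]
        refine ⟨by split_ifs at hxx <;> omega, ?_⟩
        rw [dom_ins hp hw (by split_ifs at hxx <;> omega)]
        rintro ⟨b1, b2⟩
        have : x = p + 1 := by omega
        subst this
        have : y.1 ≤ p := by omega
        simp only [this, if_true, Nat.add_sub_cancel] at b2
        exact a2.2 b2
      · simp only [if_true] at a1 a2 ⊢
        have : sh p y.1 = y.1 + 1 := by unfold sh; split_ifs <;> omega
        rw [this]
        refine ⟨by omega, ?_⟩
        rw [dom_ins hp hw (by omega), ← hxx]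
        rintro ⟨b1, b2⟩
        exact a1.2 b2
  refine ⟨fixZ (L.map (fun q => (q, K.l)) ++ (if w ∈ T then [(p + 1, c)] else []) ++
    Z2.map (fun z => (sh p z.1, z.2))), PreEnum.fix ⟨?_, ?_, ?_⟩, ?_⟩
  · rw [List.pairwise_append, List.pairwise_append]
    refine ⟨⟨?_, ?_, ?_⟩, ?_, ?_⟩
    · rw [List.pairwise_map]
      refine List.Pairwise.imp_of_mem ?_ hL3
      intro x y hx hy hxy
      have := (hFle x ((hL2 x).1 hx)).1
      have := (hFle y ((hL2 y).1 hy)).1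
      refine ⟨fun hh => absurd rfl hh, fun _ => ?_⟩
      dsimp only
      split_ifs at hxy ⊢
      · exact ⟨hxy, notdom _ _ hxy (by omega)⟩
      · exact ⟨hxy, notdom _ _ hxy (by omega)⟩
    · split_ifs <;> simp
    · intro x hx y hy
      split_ifs at hy with hT
      · rw [List.mem_singleton] at hy
        subst hy
        rw [List.mem_map] at hx
        obtain ⟨q, hq, rfl⟩ := hx
        have := hFle q ((hL2 q).1 hq)
        refine ⟨fun _ => ⟨by dsimp only; omega, ?_⟩, fun hh => absurd hh hc⟩
        dsimp only
        rw [dom_ins hp hw (by omega)]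
        refine ⟨by omega, ?_⟩
        simp only [this.1, if_true, Nat.add_sub_cancel]
        exact this.2.1
      · simp at hy
    · rw [List.pairwise_map]
      refine List.Pairwise.imp_of_mem ?_ h22
      intro x y hx hy hxy
      have hpx := h2 x hx
      have hpy := h2 y hy
      have hxp := hpx.ne
      constructor
      · intro hy2
        have a1 := hxy.1 hy2
        have a2 := hpy.1 hy2
        dsimp only at a1 a2 hxp ⊢
        have e1 : sh p y.1 = y.1 + 1 := by unfold sh; split_ifs <;> omega
        have e2 : sh p x.1 < y.1 + 1 := by unfold sh; split_ifs <;> omega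
        have e3 : (if sh p x.1 ≤ p then sh p x.1 else sh p x.1 - 1) = x.1 := by
          unfold sh; split_ifs <;> omega
        rw [e1]
        refine ⟨e2, ?_⟩
        rw [dom_ins hp hw e2, e3]
        exact ⟨by omega, a1.2⟩
      · intro hy2
        have a1 := hxy.2 hy2
        have a2 := hpy.2 hy2
        dsimp only at a1 a2 hxp ⊢
        cases b
        · simp only [Bool.false_eq_true, if_false] at a1 a2 ⊢
          have e1 : sh p y.1 = y.1 := by unfold sh; split_ifs <;> omega
          have e2 : y.1 < sh p x.1 := by unfold sh; split_ifs <;> omega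
          rw [e1]
          refine ⟨e2, ?_⟩
          rw [dom_ins hp hw e2]
          rintro ⟨b1, b2⟩
          have e3 : sh p x.1 = x.1 + 1 := by
            unfold sh at b1 ⊢; split_ifs at b1 ⊢ <;> omega
          have e4 : y.1 ≤ p := by omega
          simp only [e3, e4, if_true, Nat.add_sub_cancel] at b2
          exact a1.2 b2
        · simp only [if_true] at a1 a2 ⊢
          have e1 : sh p y.1 = y.1 + 1 := by unfold sh; split_ifs <;> omega
          have e2 : sh p x.1 < y.1 + 1 := by unfold sh; split_ifs <;> omega
          have e3 : (if sh p x.1 ≤ p then sh p x.1 else sh p x.1 - 1) = x.1 := by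
            unfold sh; split_ifs <;> omega
          rw [e1]
          refine ⟨e2, ?_⟩
          rw [dom_ins hp hw e2, e3]
          rintro ⟨b1, b2⟩
          exact a1.2 b2
    · intro x hx y hy
      rw [List.mem_map] at hy
      obtain ⟨y, hy, rfl⟩ := hy
      rw [List.mem_append, List.mem_map] at hx
      rcases hx with ⟨q, hq, rfl⟩ | hx
      · have := hFle q ((hL2 q).1 hq)
        exact relZ2 q (by omega) q this.1 (by simp [this.1]) this.2.1 c _ y hy (this.2.2 y hy)
      · split_ifs at hx with hT
        · rw [List.mem_singleton] at hx
          subst hx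
          exact relZ2 (p + 1) le_rfl p le_rfl (by simp) hpp c _ y hy (h2 y hy)
        · simp at hx
  · intro q
    have hmemZ : (∃ c', (q, c') ∈ L.map (fun q => (q, K.l)) ++
        (if w ∈ T then [(p + 1, c)] else []) ++ Z2.map (fun z => (sh p z.1, z.2))) ↔
        ((∃ c, (q, c) ∈ Z1) ∨ (w ∈ A ∧ q = p)) ∨ (w ∈ T ∧ q = p + 1) ∨
          (∃ x c', (x, c') ∈ Z2 ∧ sh p x = q) := by
      rw [← hFmem, ← hL2]
      constructor
      · rintro ⟨c', hc'⟩
        rw [List.mem_append, List.mem_append] at hc'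
        rcases hc' with (hc' | hc') | hc'
        · left; simp at hc'; exact hc'.1
        · right; left
          split_ifs at hc' with hT
          · simp at hc'; exact ⟨hT, hc'.1⟩
          · simp at hc'
        · right; right
          rw [List.mem_map] at hc'
          obtain ⟨z, hz, hz'⟩ := hc'
          exact ⟨z.1, z.2, hz, congrArg Prod.fst hz'⟩
      · rintro (hq | ⟨hT, rfl⟩ | ⟨x, c', hx, rfl⟩)
        · exact ⟨K.l, by simp [hq]⟩
        · exact ⟨c, by simp [hT]⟩
        · refine ⟨c', ?_⟩
          rw [List.mem_append, List.mem_map]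
          exact Or.inr ⟨_, hx, rfl⟩
    rw [hmemZ]
    have hold : ∀ q, (q ≤ m ∧ mark T A m f q) ↔
        (∃ c, (q, c) ∈ Z1) ∨ q = p ∨ ∃ c, (q, c) ∈ Z2 := by
      intro q
      rw [h.mem]
      constructor
      · rintro ⟨c', hc'⟩
        rw [List.mem_append, List.mem_cons] at hc'
        rcases hc' with hc' | hc' | hc'
        · exact Or.inl ⟨_, hc'⟩
        · exact Or.inr (Or.inl (congrArg Prod.fst hc'))
        · exact Or.inr (Or.inr ⟨_, hc'⟩)
      · rintro (⟨c', hc'⟩ | rfl | ⟨c', hc'⟩)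
        · exact ⟨c', by simp [hc']⟩
        · exact ⟨c, by simp⟩
        · exact ⟨c', by simp [hc']⟩
    have hZ1 : ∀ c', (q, c') ∈ Z1 → q < p := fun c' hc' => (h1 _ hc').1
    have hZ2 : ∀ x c', (x, c') ∈ Z2 → x ≠ p := fun x c' hc' => ((h2 _ hc').ne).symm
    rcases lt_trichotomy q p with hq | hq | hq
    · rw [mark_lt hp hq]
      have := hold q
      have hh : (q ≤ m + 1 ∧ mark T A m f q) ↔ (q ≤ m ∧ mark T A m f q) := by
        constructor <;> rintro ⟨_, b⟩ <;> exact ⟨by omega, b⟩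
      rw [hh, this]
      constructor
      · rintro (hh | hh | ⟨c', hc'⟩)
        · exact Or.inl (Or.inl hh)
        · omega
        · exact Or.inr (Or.inr ⟨q, c', hc', by simp [sh, hq]⟩)
      · rintro ((hh | hh) | hh | ⟨x, c', hc', hx⟩)
        · exact Or.inl hh
        · omega
        · omega
        · have := hZ2 x c' hc'
          have : x = q := by unfold sh at hx; split_ifs at hx <;> omega
          subst this
          exact Or.inr (Or.inr ⟨c', hc'⟩)
    · subst hq
      rw [mark_eq hp hw]
      constructor
      · rintro ⟨-, hh⟩
        exact Or.inl (Or.inr ⟨hh, rfl⟩)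
      · rintro ((⟨c', hh⟩ | hh) | hh | ⟨x, c', hc', hx⟩)
        · have := hZ1 _ hh
          omega
        · exact ⟨by omega, hh.1⟩
        · omega
        · have := hZ2 x c' hc'
          unfold sh at hx; split_ifs at hx <;> omega
    · obtain ⟨q, rfl⟩ : ∃ q', q = q' + 1 := ⟨q - 1, by omega⟩
      rcases (show p ≤ q by omega).eq_or_lt with hq' | hq'
      · subst hq'
        rw [mark_succ hp hw]
        constructor
        · rintro ⟨-, hh⟩
          exact Or.inr (Or.inl ⟨hh, rfl⟩)
        · rintro ((⟨c', hh⟩ | hh) | hh | ⟨x, c', hc', hx⟩)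
          · have := hZ1 _ hh
            omega
          · omega
          · exact ⟨by omega, hh.1⟩
          · have := hZ2 x c' hc'
            unfold sh at hx; split_ifs at hx <;> omega
      · constructor
        · rintro ⟨hqm, hh⟩
          have hqm' : q ≤ m := by omega
          rw [mark_gt hq' hqm'] at hh
          rcases (hold q).1 ⟨hqm', hh⟩ with ⟨c', hc'⟩ | hh | ⟨c', hc'⟩
          · have := (h1 _ hc').1
            dsimp only at this
            omega
          · omega
          · exact Or.inr (Or.inr ⟨q, c', hc', by unfold sh; split_ifs <;> omega⟩)
        · rintro ((⟨c', hh⟩ | hh) | hh | ⟨x, c', hc', hx⟩)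
          · have := hZ1 _ hh
            omega
          · omega
          · omega
          · have : x = q := by unfold sh at hx; split_ifs at hx <;> omega
            subst this
            have := (hold x).2 (Or.inr (Or.inr ⟨c', hc'⟩))
            rw [mark_gt hq' this.1]
            exact ⟨by omega, this.2⟩
  · intro z hz
    rw [List.mem_append, List.mem_append] at hz
    rcases hz with (hz | hz) | hz
    · rw [List.mem_map] at hz
      obtain ⟨q, hq, rfl⟩ := hz
      have := (hFle q ((hL2 q).1 hq)).1
      refine ⟨fun hh => by simp at hh, fun hh => ?_⟩
      dsimp only at hh
      omega
    · split_ifs at hz with hT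
      · rw [List.mem_singleton] at hz
        subst hz
        have := h.e (p, c) (by simp)
        dsimp only at this ⊢
        rw [this]
        omega
      · simp at hz
    · rw [List.mem_map] at hz
      obtain ⟨z, hz, rfl⟩ := hz
      have h4 := h.e z (by simp [hz])
      have h5 := (h2 z hz).ne
      have h6 := hm2 z hz
      dsimp only at h4 h5 ⊢
      rw [h4]
      unfold sh; split_ifs <;> omega
  · rw [fixZ_map]
    congr 1
    simp only [List.map_append, List.map_map]
    congr 1
    · congr 1
      · rw [← hFcard, ← hL1]
        rw [List.eq_replicate_iff]
        simp
      · split_ifs <;> simp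

noncomputable def cnt (P : List ℕ → Prop) : ℕ → List ℕ → ℕ
  | 0, l => if P l then 1 else 0
  | w + 1, l => ∑ p ∈ Finset.range (l.length + 1), cnt P w (l.insertIdx p (w + 1))

noncomputable def C (T A R : Finset ℕ) : ℕ → List K → ℕ
  | 0, [] => 1
  | 0, _ :: _ => 0
  | w + 1, u => ∑ i ∈ Finset.range u.length,
      match u.drop i with
      | [] => 0
      | c :: u2 => if c ≠ K.l ∧ (w + 1 ∈ R ↔ c = K.e) then
          C T A R w (fixHead (List.replicate (i + if w + 1 ∈ A then 1 else 0) K.l ++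
            (if w + 1 ∈ T then [c] else []) ++ u2)) else 0

def word (l : List ℕ) : ℕ → ℕ := fun k => l.getD k 0

lemma word_insertIdx (l : List ℕ) (p w : ℕ) (hp : p ≤ l.length) :
    word (l.insertIdx p w) = ins p w (word l) := by
  funext k
  unfold word ins
  simp only [List.getD_eq_getElem?_getD]
  rw [List.getElem?_insertIdx]
  by_cases h1 : k < p
  · simp [h1]
  · by_cases h2 : k = p
    · subst h2; simp [hp]
    · simp [h1, h2]

def Final (T A R : Finset ℕ) (b : Bool) (m : ℕ) (f : ℕ → ℕ) : Prop :=
  used T A m f ∧ rl R m f ∧ av b m f ∧ ∀ q ≤ m, ¬ mark T A m f q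

lemma final_iff {T A R : Finset ℕ} {b : Bool} {m : ℕ} {f : ℕ → ℕ} :
    Final T A R b m f ↔ Viable T A R b m f ∧ ∀ q ≤ m, ¬ mark T A m f q :=
  ⟨fun h => ⟨⟨h.1, h.2.1, h.2.2.1, fun p hp hm => absurd hm (h.2.2.2 p hp)⟩, h.2.2.2⟩,
    fun h => ⟨h.1.used, h.1.rl, h.1.av, h.2⟩⟩

lemma sum_enum {Z : List (ℕ × K)} (F : ℕ → ℕ) :
    ((Z.map Prod.fst).map F).sum = ∑ i ∈ Finset.range Z.length,
      match Z.drop i with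
      | [] => 0
      | z :: _ => F z.1 := by
  induction Z with
  | nil => simp
  | cons z Z ih =>
    rw [List.length_cons, Finset.sum_range_succ']
    simp only [List.map_cons, List.sum_cons, List.drop_succ_cons, List.drop_zero, ih]
    rw [add_comm]

lemma main_count (T A R : Finset ℕ) (b : Bool) (w : ℕ) : ∀ l : List ℕ, l.Nodup →
    (∀ x ∈ l, w < x) →
    (¬ Viable T A R b l.length (word l) →
      cnt (fun l => Final T A R b l.length (word l)) w l = 0) ∧
    (Viable T A R b l.length (word l) → ∀ Z, Enum T A b l.length (word l) Z →
      cnt (fun l => Final T A R b l.length (word l)) w l = C T A R w (Z.map Prod.snd)) := by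
  induction w with
  | zero =>
    intro l _ _
    refine ⟨?_, ?_⟩
    · intro h
      simp only [cnt]
      rw [if_neg]
      intro hf
      exact h (final_iff.1 hf).1
    · intro h Z hZ
      simp only [cnt]
      cases Z with
      | nil =>
        simp only [List.map_nil, C]
        rw [if_pos]
        rw [final_iff]
        refine ⟨h, fun q hq hm => ?_⟩
        obtain ⟨c, hc⟩ := (hZ.mem q).1 ⟨hq, hm⟩
        simp at hc
      | cons z Z =>
        simp only [List.map_cons, C]
        rw [if_neg]
        intro hf
        have := (hZ.mem z.1).2 ⟨z.2, by simp⟩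
        exact (final_iff.1 hf).2 _ this.1 this.2
  | succ w ih =>
    intro l hnd hlt
    have hw : ∀ k < l.length, w + 1 < word l k := by
      intro k hk
      unfold word
      rw [List.getD_eq_getElem _ _ hk]
      exact hlt _ (List.getElem_mem hk)
    have hinj : ∀ i < l.length, ∀ j < l.length, word l i = word l j → i = j := by
      intro i hi j hj h
      unfold word at h
      rw [List.getD_eq_getElem _ _ hi, List.getD_eq_getElem _ _ hj] at h
      exact (hnd.getElem_inj_iff).1 h
    have hstep : ∀ p ≤ l.length, (l.insertIdx p (w + 1)).Nodup ∧
        (∀ x ∈ l.insertIdx p (w + 1), w < x) ∧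
        (l.insertIdx p (w + 1)).length = l.length + 1 := by
      intro p hp
      refine ⟨?_, ?_, ?_⟩
      · rw [(List.perm_insertIdx (w + 1) l hp).nodup_iff, List.nodup_cons]
        exact ⟨fun hh => by have := hlt _ hh; omega, hnd⟩
      · intro x hx
        rw [(List.perm_insertIdx (w + 1) l hp).mem_iff, List.mem_cons] at hx
        rcases hx with rfl | hx
        · omega
        · have := hlt _ hx
          omega
      · rw [List.length_insertIdx]; simp [hp]
    have hv : ∀ p ≤ l.length, (Viable T A R b (l.insertIdx p (w + 1)).length
        (word (l.insertIdx p (w + 1))) ↔ Viable T A R b l.length (word l) ∧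
          mark T A l.length (word l) p ∧ (w + 1 ∈ R ↔ p = l.length) ∧
          insCond T A b l.length (word l) p) := by
      intro p hp
      rw [(hstep p hp).2.2, word_insertIdx _ _ _ hp, viable_ins hp hw hinj]
    have hzero : ∀ p ≤ l.length, ¬ (Viable T A R b l.length (word l) ∧
          mark T A l.length (word l) p ∧ (w + 1 ∈ R ↔ p = l.length) ∧
          insCond T A b l.length (word l) p) →
        cnt (fun l => Final T A R b l.length (word l)) w (l.insertIdx p (w + 1)) = 0 := by
      intro p hp hn
      exact (ih _ (hstep p hp).1 (hstep p hp).2.1).1 (fun h => hn ((hv p hp).1 h))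
    refine ⟨?_, ?_⟩
    · intro h
      simp only [cnt]
      apply Finset.sum_eq_zero
      intro p hp
      rw [Finset.mem_range] at hp
      exact hzero p (by omega) (fun hh => h hh.1)
    · intro h Z hZ
      simp only [cnt, C]
      have hsub : (Z.map Prod.fst).toFinset ⊆ Finset.range (l.length + 1) := by
        intro q hq
        simp only [List.mem_toFinset, List.mem_map] at hq
        obtain ⟨z, hz, rfl⟩ := hq
        have := ((hZ.mem z.1).2 ⟨z.2, hz⟩).1
        rw [Finset.mem_range]; omega
      rw [← Finset.sum_subset hsub]
      · rw [List.sum_toFinset _ hZ.nodup, sum_enum, List.length_map]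
        apply Finset.sum_congr rfl
        intro i hi
        rw [Finset.mem_range] at hi
        rw [← List.map_drop]
        have hZeq : Z = Z.take i ++ Z.drop i := (List.take_append_drop i Z).symm
        have hlen : (Z.take i).length = i := by rw [List.length_take]; omega
        generalize Z.take i = Z1 at hZeq hlen
        generalize Z.drop i = Z2 at hZeq
        cases Z2 with
        | nil => rfl
        | cons z Z2 =>
          obtain ⟨p, c⟩ := z
          rw [hZeq] at hZ
          have hmem := (hZ.mem p).2 ⟨c, by simp⟩
          have he := hZ.e (p, c) (by simp)
          have hic := hZ.insCond_iff
          rw [List.map_cons]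
          dsimp only at he ⊢
          by_cases hcond : c ≠ K.l ∧ (w + 1 ∈ R ↔ c = K.e)
          · rw [if_pos hcond]
            obtain ⟨Z', hZ', hmap⟩ := hZ.step hcond.1 hw
            rw [hlen] at hmap
            rw [← hmap]
            refine (ih _ (hstep p hmem.1).1 (hstep p hmem.1).2.1).2 ?_ Z' ?_
            · rw [hv p hmem.1]
              exact ⟨h, hmem.2, by rw [← he]; exact hcond.2, hic.2 hcond.1⟩
            · rw [(hstep p hmem.1).2.2, word_insertIdx _ _ _ hmem.1]
              exact hZ'
          · rw [if_neg hcond]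
            apply hzero p hmem.1
            rintro ⟨-, -, h3, h4⟩
            exact hcond ⟨hic.1 h4, by rw [he]; exact h3⟩
      · intro p hp hp'
        rw [Finset.mem_range] at hp
        apply hzero p (by omega)
        rintro ⟨-, h2, -⟩
        apply hp'
        obtain ⟨c, hc⟩ := (hZ.mem p).1 ⟨by omega, h2⟩
        simp only [List.mem_toFinset, List.mem_map]
        exact ⟨_, hc, rfl⟩

lemma cnt_nil (T A R : Finset ℕ) (b : Bool) (n : ℕ) :
    cnt (fun l => Final T A R b l.length (word l)) n [] = C T A R n [K.e] := by
  refine (main_count T A R b n [] (by simp) (by simp)).2 ?_ [(0, K.e)] ?_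
  · refine ⟨?_, ?_, ?_, ?_⟩
    · intro k hk; simp at hk
    · intro k hk; simp at hk
    · intro i j k t _ _ _ ht; simp at ht
    · intro p _ _
      cases b
      · simp [active]
      · simp [active]
  · refine ⟨⟨by simp, ?_, by simp⟩, ?_⟩
    · intro q
      simp [mark]
    · rintro z Z' ⟨⟩; simp

lemma countP_permutations' (P : List ℕ → Prop) (w : ℕ) : ∀ r : List ℕ,
    ((List.permutations' (List.range' 1 w ++ r)).map (fun l => if P l then 1 else 0)).sum =
      ((List.permutations' r).map (cnt P w)).sum := by
  induction w with
  | zero => intro r; rfl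
  | succ w ih =>
    intro r
    have h1 : List.range' 1 (w + 1) ++ r = List.range' 1 w ++ ((w + 1) :: r) := by
      rw [List.range'_concat, List.append_assoc]
      simp [add_comm]
    rw [h1, ih, List.permutations']
    generalize List.permutations' r = Q
    induction Q with
    | nil => simp
    | cons l Q ihQ =>
      rw [List.flatMap_cons, List.map_append, List.sum_append, ihQ, List.map_cons, List.sum_cons]
      congr 1
      simp only [cnt]
      rw [← Fin.sum_univ_getElem, ← Fin.sum_univ_eq_sum_range
        (fun p => cnt P w (l.insertIdx p (w + 1)))]
      have hlen : (List.map (cnt P w) (List.permutations'Aux (w + 1) l)).length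
        = l.length + 1 := by simp
      refine Fintype.sum_equiv (finCongr hlen) _ _ ?_
      intro i
      simp [List.getElem_permutations'Aux]

lemma card_perm_eq (n : ℕ) (P : List ℕ → Prop) :
    ((Finset.univ : Finset (Equiv.Perm (Fin n))).filter
      (fun σ => P (List.ofFn (fun i => (σ i : ℕ) + 1)))).card = cnt P n [] := by
  have h := countP_permutations' P n []
  simp only [List.append_nil, List.permutations', List.map_cons, List.map_nil, List.sum_cons,
    List.sum_nil, add_zero] at h
  rw [← h]
  have hnd : (List.permutations' (List.range' 1 n)).Nodup :=
    (List.permutations_perm_permutations' _).nodup_iff.1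
      (List.nodup_permutations _ (List.nodup_range'))
  rw [← List.sum_toFinset _ hnd, ← Finset.card_filter]
  refine Finset.card_bij (fun σ _ => List.ofFn (fun i => (σ i : ℕ) + 1)) ?_ ?_ ?_
  · intro σ hσ
    rw [Finset.mem_filter] at hσ ⊢
    refine ⟨?_, hσ.2⟩
    rw [List.mem_toFinset, List.mem_permutations']
    rw [List.perm_ext_iff_of_nodup]
    · intro x
      rw [List.mem_ofFn, List.mem_range'_1]
      constructor
      · rintro ⟨i, rfl⟩
        have := (σ i).2
        omega
      · rintro ⟨h1, h2⟩
        refine ⟨σ.symm ⟨x - 1, by omega⟩, ?_⟩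
        simp; omega
    · rw [List.nodup_ofFn]
      intro i j hij
      have : (σ i : ℕ) = σ j := by simpa using hij
      exact σ.injective (Fin.ext this)
    · exact List.nodup_range'
  · intro σ _ τ _ h
    have := List.ofFn_injective h
    ext i
    have := congrFun this i
    simpa using this
  · intro l hl
    rw [Finset.mem_filter, List.mem_toFinset, List.mem_permutations'] at hl
    obtain ⟨hl, hP⟩ := hl
    have hlen : l.length = n := by rw [hl.length_eq]; simp
    have hln : l.Nodup := hl.nodup_iff.2 List.nodup_range'
    have hb : ∀ i : Fin n, 1 ≤ l[(i : ℕ)]'(by rw [hlen]; exact i.2) ∧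
        l[(i : ℕ)]'(by rw [hlen]; exact i.2) < 1 + n := by
      intro i
      have := List.getElem_mem (l := l) (n := i) (by rw [hlen]; exact i.2)
      rw [hl.mem_iff, List.mem_range'_1] at this
      exact this
    let g : Fin n → Fin n := fun i => ⟨l[(i : ℕ)]'(by rw [hlen]; exact i.2) - 1, by
      have := hb i; omega⟩
    have hg : Function.Injective g := by
      intro i j hij
      have h1 : l[(i : ℕ)]'(by rw [hlen]; exact i.2) - 1 =
        l[(j : ℕ)]'(by rw [hlen]; exact j.2) - 1 := congrArg Fin.val hij
      have h2 := hb i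
      have h3 := hb j
      exact Fin.ext ((hln.getElem_inj_iff).1 (by omega))
    have hlist : List.ofFn (fun i => (Equiv.ofBijective g
        (Finite.injective_iff_bijective.1 hg) i : ℕ) + 1) = l := by
      apply List.ext_getElem
      · simp [hlen]
      · intro k hk1 hk2
        have := hb ⟨k, by omega⟩
        simp only [List.getElem_ofFn, Equiv.ofBijective_apply, g] at this ⊢
        omega
    refine ⟨Equiv.ofBijective g (Finite.injective_iff_bijective.1 hg), ?_, hlist⟩
    rw [Finset.mem_filter]
    refine ⟨Finset.mem_univ _, ?_⟩
    rw [hlist]; simpa using hP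


section conn
variable {n : ℕ} (σ : Equiv.Perm (Fin n))

def wd (k : ℕ) : ℕ := entry σ (k + 1)

lemma wd_lt {k : ℕ} (hk : k < n) : wd σ k = (σ ⟨k, hk⟩ : ℕ) + 1 := by
  simp [wd, entry, hk]

lemma wd_inj {i j : ℕ} (hi : i < n) (hj : j < n) (h : wd σ i = wd σ j) : i = j := by
  rw [wd_lt σ hi, wd_lt σ hj] at h
  have := σ.injective (Fin.ext (Nat.succ.inj h))
  simpa using this

lemma wd_surj {x : ℕ} (hx : x ∈ Finset.Icc 1 n) : ∃ k < n, wd σ k = x := by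
  rw [Finset.mem_Icc] at hx
  refine ⟨σ.symm ⟨x - 1, by omega⟩, (σ.symm ⟨x - 1, by omega⟩).2, ?_⟩
  rw [wd_lt σ (σ.symm ⟨x - 1, by omega⟩).2]
  simp; omega

lemma wd_mem {k : ℕ} (hk : k < n) : wd σ k ∈ Finset.Icc 1 n := by
  rw [wd_lt σ hk, Finset.mem_Icc]
  have := (σ ⟨k, hk⟩).2
  omega

lemma word_ofFn : word (List.ofFn (fun i => (σ i : ℕ) + 1)) = wd σ := by
  funext k
  unfold word
  by_cases hk : k < n
  · rw [wd_lt σ hk, List.getD_eq_getElem _ _ (by simpa using hk)]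
    simp
  · rw [List.getD_eq_default _ _ (by simpa using hk)]
    simp [wd, entry, hk]

lemma mem_Destop {x : ℕ} : x ∈ Destop σ ↔ ∃ k, k + 1 < n ∧ wd σ (k + 1) < wd σ k ∧ wd σ k = x := by
  simp only [Destop, Des, Finset.mem_image, Finset.mem_filter, Finset.mem_Icc, wd]
  constructor
  · rintro ⟨i, ⟨⟨h1, h2⟩, h3⟩, h4⟩
    obtain ⟨k, rfl⟩ : ∃ k, i = k + 1 := ⟨i - 1, by omega⟩
    exact ⟨k, by omega, h3, h4⟩
  · rintro ⟨k, h1, h2, h3⟩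
    exact ⟨k + 1, ⟨⟨by omega, by omega⟩, h2⟩, h3⟩

lemma mem_Asctop {x : ℕ} :
    x ∈ Asctop σ ↔ ∃ k, k + 1 < n ∧ wd σ k < wd σ (k + 1) ∧ wd σ (k + 1) = x := by
  simp only [Asctop, Asc, Finset.mem_image, Finset.mem_filter, Finset.mem_Icc, wd]
  constructor
  · rintro ⟨i, ⟨⟨h1, h2⟩, h3⟩, h4⟩
    obtain ⟨k, rfl⟩ : ∃ k, i = k + 1 := ⟨i - 1, by omega⟩
    exact ⟨k, by omega, h3, h4⟩
  · rintro ⟨k, h1, h2, h3⟩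
    exact ⟨k + 1, ⟨⟨by omega, by omega⟩, h2⟩, h3⟩

lemma mem_Ascbot {x : ℕ} :
    x ∈ Ascbot σ ↔ ∃ k, k + 1 < n ∧ wd σ k < wd σ (k + 1) ∧ wd σ k = x := by
  simp only [Ascbot, Asc, Finset.mem_image, Finset.mem_filter, Finset.mem_Icc, wd]
  constructor
  · rintro ⟨i, ⟨⟨h1, h2⟩, h3⟩, h4⟩
    obtain ⟨k, rfl⟩ : ∃ k, i = k + 1 := ⟨i - 1, by omega⟩
    exact ⟨k, by omega, h3, h4⟩
  · rintro ⟨k, h1, h2, h3⟩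
    exact ⟨k + 1, ⟨⟨by omega, by omega⟩, h2⟩, h3⟩

lemma mem_RLmax {x : ℕ} :
    x ∈ RLmax σ ↔ ∃ k < n, (∀ j, k < j → j < n → wd σ j < wd σ k) ∧ wd σ k = x := by
  simp only [RLmax, Finset.mem_image, Finset.mem_filter, Finset.mem_Icc, wd]
  constructor
  · rintro ⟨i, ⟨⟨h1, h2⟩, h3⟩, h4⟩
    obtain ⟨k, rfl⟩ : ∃ k, i = k + 1 := ⟨i - 1, by omega⟩
    exact ⟨k, by omega, fun j hj hj' => h3 (j + 1) (by omega) (by omega), h4⟩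
  · rintro ⟨k, h1, h2, h3⟩
    refine ⟨k + 1, ⟨⟨by omega, by omega⟩, fun j hj hj' => ?_⟩, h3⟩
    obtain ⟨j, rfl⟩ : ∃ i, j = i + 1 := ⟨j - 1, by omega⟩
    exact h2 j (by omega) (by omega)

lemma wd_Destop {k : ℕ} (hk : k < n) :
    wd σ k ∈ Destop σ ↔ k + 1 < n ∧ wd σ (k + 1) < wd σ k := by
  rw [mem_Destop]
  constructor
  · rintro ⟨j, h1, h2, h3⟩
    obtain rfl := wd_inj σ (by omega) hk h3
    exact ⟨h1, h2⟩
  · rintro ⟨h1, h2⟩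
    exact ⟨k, h1, h2, rfl⟩

lemma wd_Asctop {k : ℕ} (hk : k < n) :
    wd σ k ∈ Asctop σ ↔ 0 < k ∧ wd σ (k - 1) < wd σ k := by
  rw [mem_Asctop]
  constructor
  · rintro ⟨j, h1, h2, h3⟩
    obtain rfl := wd_inj σ (by omega) hk h3
    exact ⟨by omega, h2⟩
  · rintro ⟨h1, h2⟩
    obtain ⟨j, rfl⟩ : ∃ j, k = j + 1 := ⟨k - 1, by omega⟩
    exact ⟨j, hk, h2, rfl⟩

lemma wd_Ascbot {k : ℕ} (hk : k < n) :
    wd σ k ∈ Ascbot σ ↔ k + 1 < n ∧ wd σ k < wd σ (k + 1) := by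
  rw [mem_Ascbot]
  constructor
  · rintro ⟨j, h1, h2, h3⟩
    obtain rfl := wd_inj σ (by omega) hk h3
    exact ⟨h1, h2⟩
  · rintro ⟨h1, h2⟩
    exact ⟨k, h1, h2, rfl⟩

lemma wd_RLmax {k : ℕ} (hk : k < n) :
    wd σ k ∈ RLmax σ ↔ ∀ j, k < j → j < n → wd σ j < wd σ k := by
  rw [mem_RLmax]
  constructor
  · rintro ⟨j, h1, h2, h3⟩
    obtain rfl := wd_inj σ (by omega) hk h3
    exact h2
  · intro h
    exact ⟨k, hk, h, rfl⟩

lemma eq_iff_wd {S U : Finset ℕ} (hS : S ⊆ Finset.Icc 1 n) (hU : U ⊆ Finset.Icc 1 n) :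
    S = U ↔ ∀ k < n, (wd σ k ∈ S ↔ wd σ k ∈ U) := by
  constructor
  · rintro rfl k _; rfl
  · intro h
    ext x
    constructor
    · intro hx
      obtain ⟨k, hk, rfl⟩ := wd_surj σ (hS hx)
      exact (h k hk).1 hx
    · intro hx
      obtain ⟨k, hk, rfl⟩ := wd_surj σ (hU hx)
      exact (h k hk).2 hx

lemma Destop_sub : Destop σ ⊆ Finset.Icc 1 n := by
  intro x hx
  obtain ⟨k, h1, -, rfl⟩ := (mem_Destop σ).1 hx
  exact wd_mem σ (by omega)

lemma Asctop_sub : Asctop σ ⊆ Finset.Icc 1 n := by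
  intro x hx
  obtain ⟨k, h1, -, rfl⟩ := (mem_Asctop σ).1 hx
  exact wd_mem σ (by omega)

lemma Ascbot_sub : Ascbot σ ⊆ Finset.Icc 1 n := by
  intro x hx
  obtain ⟨k, h1, -, rfl⟩ := (mem_Ascbot σ).1 hx
  exact wd_mem σ (by omega)

lemma RLmax_sub : RLmax σ ⊆ Finset.Icc 1 n := by
  intro x hx
  obtain ⟨k, h1, -, rfl⟩ := (mem_RLmax σ).1 hx
  exact wd_mem σ (by omega)

lemma Ascbot_eq : Ascbot σ = (Finset.Icc 1 n).filter (fun x => x ∉ Destop σ ∧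
    ¬ (x ∈ RLmax σ ∧ ∀ y ∈ RLmax σ, x ≤ y)) := by
  rw [eq_iff_wd σ (Ascbot_sub σ) (Finset.filter_subset _ _)]
  intro k hk
  rw [wd_Ascbot σ hk, Finset.mem_filter, wd_Destop σ hk]
  have hlast : wd σ (n - 1) ∈ RLmax σ := by
    rw [wd_RLmax σ (by omega)]
    intro j h1 h2; omega
  by_cases hk1 : k + 1 < n
  · have hne : wd σ k ≠ wd σ (k + 1) := fun h => by
      have := wd_inj σ hk hk1 h
      omega
    constructor
    · rintro ⟨-, h⟩
      refine ⟨wd_mem σ hk, by omega, ?_⟩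
      rintro ⟨h1, -⟩
      have := (wd_RLmax σ hk).1 h1 (k + 1) (by omega) hk1
      omega
    · rintro ⟨-, h, -⟩
      exact ⟨hk1, by omega⟩
  · have hkn : k = n - 1 := by omega
    constructor
    · rintro ⟨h, -⟩; omega
    · rintro ⟨-, -, h⟩
      exfalso
      apply h
      subst hkn
      refine ⟨hlast, ?_⟩
      intro y hy
      obtain ⟨j, hj, h2, rfl⟩ := (mem_RLmax σ).1 hy
      by_cases hjn : j = n - 1
      · rw [hjn]
      · exact (h2 (n - 1) (by omega) (by omega)).le

lemma avoids_iff (b : Bool) :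
    av b n (wd σ) ↔ AvoidsPat (if b = true then ![0, 3, 1, 2] else ![1, 3, 0, 2]) σ := by
  have key : Contains (if b = true then ![0, 3, 1, 2] else ![1, 3, 0, 2] : Fin 4 → Fin 4) σ ↔
      ∃ i j k t : Fin n, i < j ∧ j < k ∧ k < t ∧
        if b = true then (σ i < σ k ∧ σ k < σ t ∧ σ t < σ j)
        else (σ k < σ i ∧ σ i < σ t ∧ σ t < σ j) := by
    constructor
    · rintro ⟨f, hf, h⟩
      refine ⟨f 0, f 1, f 2, f 3, hf (by decide), hf (by decide), hf (by decide), ?_⟩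
      cases b
      · exact ⟨(h 2 0).1 (by decide), (h 0 3).1 (by decide), (h 3 1).1 (by decide)⟩
      · exact ⟨(h 0 2).1 (by decide), (h 2 3).1 (by decide), (h 3 1).1 (by decide)⟩
    · rintro ⟨i, j, k, t, h1, h2, h3, h4⟩
      refine ⟨![i, j, k, t], ?_, ?_⟩
      · rw [Fin.strictMono_iff_lt_succ]
        intro a
        fin_cases a
        · exact h1
        · exact h2
        · exact h3
      · cases b
        · simp only [Bool.false_eq_true, if_false] at h4 ⊢
          obtain ⟨h4, h5, h6⟩ := h4
          intro x y
          fin_cases x <;> fin_cases y <;> simp <;> order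
        · simp only [if_true] at h4 ⊢
          obtain ⟨h4, h5, h6⟩ := h4
          intro x y
          fin_cases x <;> fin_cases y <;> simp <;> order
  rw [AvoidsPat, key]
  constructor
  · rintro h ⟨i, j, k, t, h1, h2, h3, h4⟩
    have := h i j k t h1 h2 h3 t.2
    rw [wd_lt σ i.2, wd_lt σ j.2, wd_lt σ k.2, wd_lt σ t.2] at this
    cases b
    · simp only [Bool.false_eq_true, if_false, Fin.lt_def, Fin.eta] at h4 this
      omega
    · simp only [if_true, Fin.lt_def, Fin.eta] at h4 this
      omega
  · intro h i j k t h1 h2 h3 h4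
    have hk : k < n := by omega
    have hj : j < n := by omega
    have hi : i < n := by omega
    rw [wd_lt σ hi, wd_lt σ hj, wd_lt σ hk, wd_lt σ h4]
    have hn : ¬ _ := fun hh => h ⟨⟨i, hi⟩, ⟨j, hj⟩, ⟨k, hk⟩, ⟨t, h4⟩, h1, h2, h3, hh⟩
    cases b
    · simp only [Bool.false_eq_true, if_false, Fin.lt_def] at hn ⊢
      omega
    · simp only [if_true, Fin.lt_def] at hn ⊢
      omega

lemma final_wd (hn : 0 < n) {T A R : Finset ℕ} (hT : T ⊆ Finset.Icc 1 n)
    (hA : A ⊆ Finset.Icc 1 n) (hR : R ⊆ Finset.Icc 1 n) (b : Bool) :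
    Final T A R b n (wd σ) ↔
      AvoidsPat (if b = true then ![0, 3, 1, 2] else ![1, 3, 0, 2]) σ ∧ Destop σ = T ∧
        Asctop σ = A ∧ RLmax σ = R := by
  rw [eq_iff_wd σ (Destop_sub σ) hT, eq_iff_wd σ (Asctop_sub σ) hA, eq_iff_wd σ (RLmax_sub σ) hR,
    ← avoids_iff]
  have hne : ∀ k, k + 1 < n → wd σ k ≠ wd σ (k + 1) := by
    intro k hk h
    have := wd_inj σ (by omega) hk h
    omega
  constructor
  · rintro ⟨hu, hr, ha, hm⟩
    refine ⟨ha, ?_, ?_, ?_⟩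
    · intro k hk
      rw [wd_Destop σ hk]
      constructor
      · rintro ⟨h1, h2⟩
        exact (hu k h1).1 h2
      · intro h
        have h3 := hm (k + 1) (by omega)
        unfold mark at h3
        rw [if_neg (by omega), if_neg (by omega)] at h3
        by_cases hkn : k + 1 = n
        · rw [if_pos hkn] at h3
          have hkk : k = n - 1 := by omega
          exact absurd (hkk ▸ h) h3
        · rw [if_neg hkn] at h3
          have := hne k (by omega)
          refine ⟨by omega, ?_⟩
          by_contra hc
          rw [if_neg (by simpa using hc)] at h3
          exact h3 h
    · intro k hk
      rw [wd_Asctop σ hk]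
      constructor
      · rintro ⟨h1, h2⟩
        obtain ⟨j, rfl⟩ : ∃ j, k = j + 1 := ⟨k - 1, by omega⟩
        exact (hu j hk).2 h2
      · intro h
        have h3 := hm k (by omega)
        unfold mark at h3
        rw [if_neg (by omega)] at h3
        by_cases hk0 : k = 0
        · subst hk0
          rw [if_pos rfl] at h3
          exact absurd h h3
        · rw [if_neg hk0, if_neg (by omega)] at h3
          refine ⟨by omega, ?_⟩
          by_contra hc
          obtain ⟨j, rfl⟩ : ∃ j, k = j + 1 := ⟨k - 1, by omega⟩
          have := hne j hk
          simp only [Nat.add_sub_cancel] at h3 hc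
          rw [if_pos (by omega)] at h3
          exact h3 h
    · intro k hk
      rw [wd_RLmax σ hk, hr k hk]
  · rintro ⟨ha, hd, hat, hr⟩
    refine ⟨?_, ?_, ha, ?_⟩
    · intro k hk
      refine ⟨fun h => (hd k (by omega)).1 ((wd_Destop σ (by omega)).2 ⟨hk, h⟩), fun h =>
        (hat (k + 1) hk).1 ((wd_Asctop σ hk).2 ⟨by omega, h⟩)⟩
    · intro k hk
      rw [← hr k hk, wd_RLmax σ hk]
    · intro q hq hm
      unfold mark at hm
      rw [if_neg (by omega)] at hm
      split_ifs at hm with h0 h1 h2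
      · have := (wd_Asctop σ hn).1 ((hat 0 hn).2 hm)
        omega
      · have := (wd_Destop σ (k := n - 1) (by omega)).1 ((hd (n - 1) (by omega)).2 hm)
        omega
      · have := (wd_Asctop σ (k := q) (by omega)).1 ((hat q (by omega)).2 hm)
        omega
      · have := (wd_Destop σ (k := q - 1) (by omega)).1 ((hd (q - 1) (by omega)).2 hm)
        rw [Nat.sub_add_cancel (by omega)] at this
        omega

end conn

lemma three_count {n : ℕ} (hn : 0 < n) {T A R : Finset ℕ} (hT : T ⊆ Finset.Icc 1 n)
    (hA : A ⊆ Finset.Icc 1 n) (hR : R ⊆ Finset.Icc 1 n) (b : Bool) :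
    ((Finset.univ : Finset (Equiv.Perm (Fin n))).filter
      (fun σ => AvoidsPat (if b = true then ![0, 3, 1, 2] else ![1, 3, 0, 2]) σ ∧ Destop σ = T ∧
        Asctop σ = A ∧ RLmax σ = R)).card = C T A R n [K.e] := by
  rw [← cnt_nil T A R b n, ← card_perm_eq]
  congr 1
  apply Finset.filter_congr
  intro σ _
  rw [← final_wd σ hn hT hA hR, word_ofFn, List.length_ofFn]

lemma five_count {n : ℕ} (hn : 0 < n) {T A B P R : Finset ℕ} (hT : T ⊆ Finset.Icc 1 n)
    (hA : A ⊆ Finset.Icc 1 n) (hR : R ⊆ Finset.Icc 1 n) (b : Bool) :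
    ((Finset.univ : Finset (Equiv.Perm (Fin n))).filter
      (fun σ => AvoidsPat (if b = true then ![0, 3, 1, 2] else ![1, 3, 0, 2]) σ ∧ Destop σ = T ∧
        Asctop σ = A ∧ Ascbot σ = B ∧ Peak σ = P ∧ RLmax σ = R)).card =
    if ((Finset.Icc 1 n).filter (fun x => x ∉ T ∧ ¬ (x ∈ R ∧ ∀ y ∈ R, x ≤ y)) = B ∧ T ∩ A = P) then
      C T A R n [K.e] else 0 := by
  by_cases h : ((Finset.Icc 1 n).filter
      (fun x => x ∉ T ∧ ¬ (x ∈ R ∧ ∀ y ∈ R, x ≤ y)) = B ∧ T ∩ A = P)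
  · rw [if_pos h, ← three_count hn hT hA hR b]
    congr 1
    apply Finset.filter_congr
    intro σ _
    constructor
    · rintro ⟨h1, h2, h3, -, -, h4⟩
      exact ⟨h1, h2, h3, h4⟩
    · rintro ⟨h1, h2, h3, h4⟩
      refine ⟨h1, h2, h3, ?_, ?_, h4⟩
      · rw [Ascbot_eq, h2, h4]; exact h.1
      · rw [Peak, h2, h3]; exact h.2
  · rw [if_neg h, Finset.card_eq_zero, Finset.filter_eq_empty_iff]
    rintro σ - ⟨h1, h2, h3, h4, h5, h6⟩
    apply h
    rw [Ascbot_eq, h2, h6] at h4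
    rw [Peak, h2, h3] at h5
    exact ⟨h4, h5⟩

end Wilf

/-- The patterns 2413 and 1423 are
`(Destop, Asctop, Ascbot, Peak, RLmax)`-Wilf equivalent. -/
theorem wilf_2413_1423 (n : ℕ) (T At Ab P R : Finset ℕ)
    (hT : T ⊆ Finset.Icc 1 n) (hAt : At ⊆ Finset.Icc 1 n) (hAb : Ab ⊆ Finset.Icc 1 n)
    (hP : P ⊆ Finset.Icc 1 n) (hR : R ⊆ Finset.Icc 1 n) :
    ((Finset.univ : Finset (Equiv.Perm (Fin n))).filter
        (fun σ => AvoidsPat (![1, 3, 0, 2] : Fin 4 → Fin 4) σ ∧ Destop σ = T ∧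
          Asctop σ = At ∧ Ascbot σ = Ab ∧ Peak σ = P ∧ RLmax σ = R)).card =
      ((Finset.univ : Finset (Equiv.Perm (Fin n))).filter
        (fun σ => AvoidsPat (![0, 3, 1, 2] : Fin 4 → Fin 4) σ ∧ Destop σ = T ∧
          Asctop σ = At ∧ Ascbot σ = Ab ∧ Peak σ = P ∧ RLmax σ = R)).card := by
  rcases Nat.eq_zero_or_pos n with rfl | hn
  · congr 1
    apply Finset.filter_congr
    intro σ _
    have h : ∀ π : Fin 4 → Fin 4, AvoidsPat π σ := by
      rintro π ⟨f, -⟩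
      exact (f 0).elim0
    simp only [h, true_and]
  · have h1 := Wilf.five_count (B := Ab) (P := P) hn hT hAt hR false
    have h2 := Wilf.five_count (B := Ab) (P := P) hn hT hAt hR true
    simp only [Bool.false_eq_true, if_false] at h1
    simp only [if_true] at h2
    rw [h1, h2]
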